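/- Let S be an inverse semigroup, let s ∈ S, let e be an idempotent of S with s D e, and let f ∈ S with f ≤ e in the natural partial order. Then there is a bijection between the sets { t ∈ S : t ≤ s and t D f } and { g ∈ S : g ≤ e and g D f }; in particular these sets have the same cardinality. -/

import Mathlib

/-- An inverse semigroup: a nonempty semigroup in which every element `x` has a
unique element `y` with `x*y*x = x` and `y*x*y = y`; this `y` is `inv x`. -/
class InverseSemigroup (S : Type*) extends Semigroup S where
  nonempty : Nonempty S
  inv : S → S
  mul_inv_mul : ∀ x : S, x * inv x * x = x
  inv_mul_inv : ∀ x : S, inv x * x * inv x = inv x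
  inv_unique : ∀ x y : S, x * y * x = x → y * x * y = y → y = inv x

namespace InverseSemigroup

variable {S : Type*}

/-- The natural partial order: `s ≤ t` iff `s = e * t` for some idempotent `e`. -/
def nle [InverseSemigroup S] (s t : S) : Prop := ∃ e : S, e * e = e ∧ s = e * t

/-- Strict version of the natural partial order. -/
def nlt [InverseSemigroup S] (s t : S) : Prop := nle s t ∧ s ≠ t

/-- Green's D-relation: `s D t` iff there is `z` with `z⁻¹z = t⁻¹t` and `zz⁻¹ = ss⁻¹`. -/
def dRel [InverseSemigroup S] (s t : S) : Prop :=
  ∃ z : S, inv z * z = inv t * t ∧ z * inv z = s * inv s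

/-- `m` is the minimum element of the semilattice of idempotents `(E(S), ≤)`. -/
def IsMinIdem [InverseSemigroup S] (m : S) : Prop :=
  m * m = m ∧ ∀ f : S, f * f = f → nle m f

/-- `e` is a lonely idempotent (relative to the minimum idempotent `m`):
`G_e = {e}`, `{e}` is a D-class, `e` covers `m` in `E(S)`, and `e` is not
covered by any idempotent. -/
def Lonely [InverseSemigroup S] (m e : S) : Prop :=
  e * e = e ∧
  (∀ s : S, s * inv s = e → inv s * s = e → s = e) ∧
  (∀ s : S, dRel s e → s = e) ∧
  nlt m e ∧ (¬ ∃ h : S, h * h = h ∧ nlt m h ∧ nlt h e) ∧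
  ¬ ∃ h : S, h * h = h ∧ nlt e h ∧ ¬ ∃ h' : S, h' * h' = h' ∧ nlt e h' ∧ nlt h' h

end InverseSemigroup

open InverseSemigroup

namespace InverseSemigroup

variable {S : Type*} [InverseSemigroup S]

theorem inv_inv' (x : S) : inv (inv x) = x :=
  (inv_unique _ _ (inv_mul_inv x) (mul_inv_mul x)).symm

theorem inv_of_idem {e : S} (he : e * e = e) : inv e = e :=
  (inv_unique e e (by rw [he, he]) (by rw [he, he])).symm

theorem mul_inv_idem (x : S) : x * inv x * (x * inv x) = x * inv x := by
  rw [← mul_assoc, mul_inv_mul]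

theorem inv_mul_idem (x : S) : inv x * x * (inv x * x) = inv x * x := by
  rw [← mul_assoc, inv_mul_inv]

theorem idem_mul_idem {e f : S} (he : e * e = e) (hf : f * f = f) :
    e * f * (e * f) = e * f := by
  have h₁ := mul_inv_mul (e * f)
  have h₂ := inv_mul_inv (e * f)
  have h₃ : f * inv (e * f) * e = inv (e * f) := by
    apply inv_unique <;> grind
  have h₄ : inv (e * f) * inv (e * f) = inv (e * f) := by grind
  have h₅ := inv_of_idem h₄
  rw [inv_inv'] at h₅
  rwa [← h₅] at h₄

theorem idem_comm {e f : S} (he : e * e = e) (hf : f * f = f) : e * f = f * e := by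
  have h₁ := idem_mul_idem he hf
  have h₂ := idem_mul_idem hf he
  have h₃ : f * e = inv (e * f) := by
    apply inv_unique <;> grind
  rw [h₃, inv_of_idem h₁]

theorem inv_mul_rev (x y : S) : inv (x * y) = inv y * inv x := by
  have hc := idem_comm (inv_mul_idem x) (mul_inv_idem y)
  have hx := mul_inv_mul x
  have hy := mul_inv_mul y
  have hx' := inv_mul_inv x
  have hy' := inv_mul_inv y
  symm
  apply inv_unique
  · calc x * y * (inv y * inv x) * (x * y)
        = x * ((y * inv y) * (inv x * x)) * y := by simp only [mul_assoc]
      _ = (x * inv x * x) * (y * inv y * y) := by rw [← hc]; simp only [mul_assoc]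
      _ = x * y := by rw [hx, hy]
  · calc inv y * inv x * (x * y) * (inv y * inv x)
        = inv y * ((inv x * x) * (y * inv y)) * inv x := by simp only [mul_assoc]
      _ = (inv y * y * inv y) * (inv x * x * inv x) := by rw [hc]; simp only [mul_assoc]
      _ = inv y * inv x := by rw [hx', hy']

/-- Conjugating an idempotent gives an idempotent. -/
theorem conj_idem {g : S} (hg : g * g = g) (z : S) :
    z * g * inv z * (z * g * inv z) = z * g * inv z := by
  have hc := idem_comm (inv_mul_idem z) hg
  calc z * g * inv z * (z * g * inv z)
      = z * g * ((inv z * z) * g) * inv z := by simp only [mul_assoc]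
    _ = z * (g * g) * (inv z * z * inv z) := by rw [hc]; simp only [mul_assoc]
    _ = z * g * inv z := by rw [hg, inv_mul_inv]

theorem idem_of_nle_idem {g e : S} (he : e * e = e) (h : nle g e) : g * g = g := by
  obtain ⟨k, hk, rfl⟩ := h
  exact idem_mul_idem hk he

theorem mul_eq_of_nle_idem {g e : S} (he : e * e = e) (h : nle g e) : g * e = g := by
  obtain ⟨k, hk, rfl⟩ := h
  rw [mul_assoc, he]

theorem mul_inv_mul_of_nle {t s : S} (h : nle t s) : t * inv t * s = t := by
  obtain ⟨a, ha, rfl⟩ := h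
  rw [inv_mul_rev, inv_of_idem ha]
  have hc := idem_comm ha (mul_inv_idem s)
  calc a * s * (inv s * a) * s = a * ((s * inv s) * a) * s := by simp only [mul_assoc]
    _ = (a * a) * (s * inv s * s) := by rw [← hc]; simp only [mul_assoc]
    _ = a * s := by rw [ha, mul_inv_mul]

theorem mul_inv_mul_mul_inv_of_nle {t s : S} (h : nle t s) :
    t * inv t * (s * inv s) = t * inv t := by
  obtain ⟨a, ha, rfl⟩ := h
  rw [inv_mul_rev, inv_of_idem ha]
  have hc := idem_comm ha (mul_inv_idem s)
  have hs := mul_inv_idem s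
  calc a * s * (inv s * a) * (s * inv s) = a * ((s * inv s) * (a * (s * inv s))) := by
        simp only [mul_assoc]
    _ = a * ((s * inv s) * (s * inv s)) * a := by rw [hc]; simp only [mul_assoc]
    _ = a * s * (inv s * a) := by rw [hs]; simp only [mul_assoc]

/-- Only `t * inv t` matters for the class of `t`, and conjugating it by `z` does not change the
class when it lies below `inv z * z`. -/
theorem dRel_conj {t u f z : S} (h : dRel t f) (hz : t * inv t * (inv z * z) = t * inv t)
    (hu : u * inv u = z * (t * inv t) * inv z) : dRel u f := by
  obtain ⟨w, hw₁, hw₂⟩ := h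
  refine ⟨z * w, ?_, ?_⟩
  · rw [inv_mul_rev, ← hw₁]
    rw [← hw₂] at hz
    calc inv w * inv z * (z * w) = inv w * (inv z * z) * w := by simp only [mul_assoc]
      _ = inv w * w * inv w * (inv z * z) * w := by rw [inv_mul_inv]
      _ = inv w * (w * inv w * (inv z * z)) * w := by simp only [mul_assoc]
      _ = inv w * w * inv w * w := by rw [hz]; simp only [mul_assoc]
      _ = inv w * w := by rw [inv_mul_inv]
  · rw [inv_mul_rev, hu, ← hw₂]; simp only [mul_assoc]

end InverseSemigroup

/-- For s D e with e idempotent and f ≤ e, the sets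
{t : t ≤ s and t D f} and {g : g ≤ e and g D f} are in bijection. -/
theorem bijOn_below_dClass
    {S : Type*} [InverseSemigroup S]
    (s e f : S) (he : e * e = e) (hse : dRel s e) (hfe : nle f e) :
    ∃ ψ : S → S,
      Set.BijOn ψ {t : S | nle t s ∧ dRel t f} {g : S | nle g e ∧ dRel g f} := by
  obtain ⟨z, hz, hzs⟩ := hse
  rw [inv_of_idem he, he] at hz
  have key {g : S} (hg : nle g e) :
      z * g * inv z * s * inv (z * g * inv z * s) = z * g * inv z := by
    have hi := conj_idem (idem_of_nle_idem he hg) z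
    rw [inv_mul_rev, inv_of_idem hi]
    calc z * g * inv z * s * (inv s * (z * g * inv z))
        = z * g * inv z * (s * inv s) * (z * g * inv z) := by simp only [mul_assoc]
      _ = z * g * (inv z * z * inv z) * (z * g * inv z) := by
          rw [← hzs]; simp only [mul_assoc]
      _ = z * g * inv z := by rw [inv_mul_inv, hi]
  have conj_conj {g : S} (hg : nle g e) : inv z * (z * g * inv z) * z = g := by
    have hge := mul_eq_of_nle_idem he hg
    calc inv z * (z * g * inv z) * z = (inv z * z) * (g * (inv z * z)) := by
          simp only [mul_assoc]
      _ = g := by rw [hz, hge, idem_comm he (idem_of_nle_idem he hg), hge]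
  refine ⟨fun t => inv z * (t * inv t) * z,
    Set.InvOn.bijOn (f' := fun g => z * g * inv z * s) ⟨?_, ?_⟩ ?_ ?_⟩
  · rintro t ⟨ht, -⟩
    have h := mul_inv_mul_mul_inv_of_nle ht
    have hc := idem_comm (mul_inv_idem t) (mul_inv_idem s)
    calc z * (inv z * (t * inv t) * z) * inv z * s
        = (z * inv z) * (t * inv t) * (z * inv z) * s := by simp only [mul_assoc]
      _ = t := by rw [hzs, ← hc, h, h, mul_inv_mul_of_nle ht]
  · rintro g ⟨hg, -⟩
    simp only [key hg, conj_conj hg]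
  · rintro t ⟨ht, htf⟩
    have hi := conj_idem (mul_inv_idem t) (inv z)
    rw [inv_inv'] at hi
    refine ⟨⟨_, hi, ?_⟩, dRel_conj (z := inv z) htf ?_ ?_⟩
    · rw [← hz]
      simp only [mul_assoc]
      rw [← mul_assoc z (inv z) z, mul_inv_mul]
    · rw [inv_inv', hzs, mul_inv_mul_mul_inv_of_nle ht]
    · rw [inv_of_idem hi, hi, inv_inv']
  · rintro g ⟨hg, hgf⟩
    have hgi := idem_of_nle_idem he hg
    refine ⟨⟨_, conj_idem hgi z, rfl⟩, dRel_conj (z := z) hgf ?_ ?_⟩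
    · rw [inv_of_idem hgi, hgi, hz, mul_eq_of_nle_idem he hg]
    · rw [key hg, inv_of_idem hgi, hgi]
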